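/- arXiv:2205.09056 — 9 statements merged into one kernel-verified Lean document; each statement's English description precedes it below -/
import Mathlib

section
/- Suppose π and π' are policies with ‖π − π'‖_{1,∞} ≤ c, and d and d' are state distributions with ‖d − d'‖₁ ≤ δ. Then ‖d𝐏^π − d'𝐏^{π'}‖₁ ≤ c + δ. -/
open Finset

/-- A policy: nonnegative, rows sum to one. -/
def IsPolicy {S A : Type*} [Fintype A] (π : S → A → ℝ) : Prop :=
  (∀ s a, 0 ≤ π s a) ∧ ∀ s, ∑ a, π s a = 1

/-- A transition function: nonnegative, rows sum to one. -/
def IsTransition {S A : Type*} [Fintype S] (P : S → A → S → ℝ) : Prop :=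
  (∀ s a s', 0 ≤ P s a s') ∧ ∀ s a, ∑ s', P s a s' = 1

/-- A state distribution. -/
def IsDistribution {S : Type*} [Fintype S] (d : S → ℝ) : Prop :=
  (∀ s, 0 ≤ d s) ∧ ∑ s, d s = 1

/-- The row-stochastic matrix 𝐏^π induced by a policy π. -/
def pmat {S A : Type*} [Fintype A] (P : S → A → S → ℝ) (π : S → A → ℝ) : S → S → ℝ :=
  fun s s' => ∑ a, π s a * P s a s'

/-- Action of a distribution (row vector) on a matrix: (dM)(s') = Σ_s d(s) M(s,s'). -/
def dApply {S : Type*} [Fintype S] (d : S → ℝ) (M : S → S → ℝ) : S → ℝ :=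
  fun s' => ∑ s, d s * M s s'

/-- ℓ¹ norm of a vector over a finite state space. -/
def l1 {S : Type*} [Fintype S] (v : S → ℝ) : ℝ := ∑ s, |v s|

theorem stmt2 {S A : Type*} [Fintype S] [Fintype A] [Nonempty S] [Nonempty A]
    (P : S → A → S → ℝ) (hP : IsTransition P)
    (π π' : S → A → ℝ) (hπ : IsPolicy π) (hπ' : IsPolicy π')
    (c : ℝ) (hc : ∀ s, ∑ a, |π s a - π' s a| ≤ c)
    (d d' : S → ℝ) (hd : IsDistribution d) (hd' : IsDistribution d')
    (δ : ℝ) (hδ : l1 (fun s => d s - d' s) ≤ δ) :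
    l1 (fun s' => dApply d (pmat P π) s' - dApply d' (pmat P π') s') ≤ c + δ := by
  have key : ∀ s', |dApply d (pmat P π) s' - dApply d' (pmat P π') s'|
      ≤ ∑ s, ∑ a, |d s * π s a - d' s * π' s a| * P s a s' := by
    intro s'
    have e : dApply d (pmat P π) s' - dApply d' (pmat P π') s'
        = ∑ s, ∑ a, (d s * π s a - d' s * π' s a) * P s a s' := by
      simp only [dApply, pmat, Finset.mul_sum, ← Finset.sum_sub_distrib]
      refine Finset.sum_congr rfl fun s _ => Finset.sum_congr rfl fun a _ => ?_
      ring
    rw [e]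
    refine (Finset.abs_sum_le_sum_abs _ _).trans (Finset.sum_le_sum fun s _ => ?_)
    refine (Finset.abs_sum_le_sum_abs _ _).trans (Finset.sum_le_sum fun a _ => ?_)
    rw [abs_mul, abs_of_nonneg (hP.1 s a s')]
  have pt : ∀ s a, |d s * π s a - d' s * π' s a|
      ≤ d s * |π s a - π' s a| + |d s - d' s| * π' s a := by
    intro s a
    have e : d s * π s a - d' s * π' s a
        = d s * (π s a - π' s a) + (d s - d' s) * π' s a := by ring
    rw [e]
    refine (abs_add_le _ _).trans ?_
    rw [abs_mul, abs_mul, abs_of_nonneg (hd.1 s), abs_of_nonneg (hπ'.1 s a)]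
  unfold l1 at *
  calc ∑ s', |dApply d (pmat P π) s' - dApply d' (pmat P π') s'|
      ≤ ∑ s', ∑ s, ∑ a, |d s * π s a - d' s * π' s a| * P s a s' :=
        Finset.sum_le_sum fun s' _ => key s'
    _ = ∑ s, ∑ a, |d s * π s a - d' s * π' s a| := by
        rw [Finset.sum_comm]
        refine Finset.sum_congr rfl fun s _ => ?_
        rw [Finset.sum_comm]
        refine Finset.sum_congr rfl fun a _ => ?_
        rw [← Finset.mul_sum, hP.2, mul_one]
    _ ≤ ∑ s, (d s * c + |d s - d' s|) := by
        refine Finset.sum_le_sum fun s _ => ?_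
        refine (Finset.sum_le_sum fun a _ => pt s a).trans ?_
        rw [Finset.sum_add_distrib, ← Finset.mul_sum, ← Finset.mul_sum, hπ'.2, mul_one]
        have := mul_le_mul_of_nonneg_left (hc s) (hd.1 s)
        linarith
    _ ≤ c + δ := by
        rw [Finset.sum_add_distrib, ← Finset.sum_mul, hd.2, one_mul]
        linarith
end

section
/- Let K ≥ 1 and let π_1,…,π_K and π'_1,…,π'_K be two sequences of policies with ‖π_k − π'_k‖_{1,∞} ≤ c for every k, and let d and d' be state distributions with ‖d − d'‖₁ ≤ δ. Then ‖d(𝐏^{π_1}𝐏^{π_2}⋯𝐏^{π_K}) − d'(𝐏^{π'_1}𝐏^{π'_2}⋯𝐏^{π'_K})‖₁ ≤ Kc + δ. -/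
open Finset

/-- Iterated action of the kernels 𝐏^{πs 0}, 𝐏^{πs 1}, … on an initial distribution d:
`rollout P πs d k = d · 𝐏^{πs 0} ⋯ 𝐏^{πs (k-1)}`. -/
def rollout {S A : Type*} [Fintype S] [Fintype A] (P : S → A → S → ℝ)
    (πs : ℕ → S → A → ℝ) (d : S → ℝ) : ℕ → S → ℝ
  | 0 => d
  | k + 1 => dApply (rollout P πs d k) (pmat P (πs k))

lemma step_dist {S A : Type*} [Fintype S] [Fintype A]
    (P : S → A → S → ℝ) (hP : IsTransition P) (π : S → A → ℝ) (hπ : IsPolicy π)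
    (d : S → ℝ) (hd : IsDistribution d) : IsDistribution (dApply d (pmat P π)) := by
  refine ⟨fun s' => Finset.sum_nonneg fun s _ => mul_nonneg (hd.1 s)
    (Finset.sum_nonneg fun a _ => mul_nonneg (hπ.1 s a) (hP.1 s a s')), ?_⟩
  unfold dApply pmat
  rw [Finset.sum_comm, ← hd.2]
  refine Finset.sum_congr rfl fun s _ => ?_
  rw [← Finset.mul_sum, Finset.sum_comm]
  simp only [← Finset.mul_sum, hP.2, mul_one, hπ.2]

lemma push_l1 {S A : Type*} [Fintype S] [Fintype A]
    (P : S → A → S → ℝ) (hP : IsTransition P) (w : S → A → ℝ) :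
    ∑ s', |∑ s, ∑ a, w s a * P s a s'| ≤ ∑ s, ∑ a, |w s a| := by
  calc ∑ s', |∑ s, ∑ a, w s a * P s a s'|
      ≤ ∑ s', ∑ s, ∑ a, |w s a| * P s a s' := by
        refine Finset.sum_le_sum fun s' _ => (Finset.abs_sum_le_sum_abs _ _).trans ?_
        refine Finset.sum_le_sum fun s _ => (Finset.abs_sum_le_sum_abs _ _).trans ?_
        refine Finset.sum_le_sum fun a _ => ?_
        rw [abs_mul, abs_of_nonneg (hP.1 s a s')]
    _ = ∑ s, ∑ a, |w s a| := by
        rw [Finset.sum_comm]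
        refine Finset.sum_congr rfl fun s _ => ?_
        rw [Finset.sum_comm]
        simp only [← Finset.mul_sum, hP.2, mul_one]

lemma step_l1 {S A : Type*} [Fintype S] [Fintype A]
    (P : S → A → S → ℝ) (hP : IsTransition P) (π π' : S → A → ℝ) (hπ' : IsPolicy π')
    (c : ℝ) (hc : ∀ s, ∑ a, |π s a - π' s a| ≤ c)
    (d d' : S → ℝ) (hd : IsDistribution d) :
    l1 (fun s => dApply d (pmat P π) s - dApply d' (pmat P π') s)
      ≤ c + l1 (fun s => d s - d' s) := by
  have h := push_l1 P hP (fun s a => d s * π s a - d' s * π' s a)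
  have e : ∀ s', ∑ s, ∑ a, (d s * π s a - d' s * π' s a) * P s a s'
      = dApply d (pmat P π) s' - dApply d' (pmat P π') s' := by
    intro s'
    simp only [dApply, pmat, Finset.mul_sum, ← Finset.sum_sub_distrib]
    exact Finset.sum_congr rfl fun s _ => Finset.sum_congr rfl fun a _ => by ring
  simp only [e] at h
  refine h.trans ?_
  have hs : ∀ s, ∑ a, |d s * π s a - d' s * π' s a| ≤ d s * c + |d s - d' s| := by
    intro s
    calc ∑ a, |d s * π s a - d' s * π' s a|
        ≤ ∑ a, (d s * |π s a - π' s a| + |d s - d' s| * π' s a) := by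
          refine Finset.sum_le_sum fun a _ => ?_
          have : d s * π s a - d' s * π' s a
            = d s * (π s a - π' s a) + (d s - d' s) * π' s a := by ring
          rw [this]
          refine (abs_add_le _ _).trans ?_
          rw [abs_mul, abs_mul, abs_of_nonneg (hd.1 s), abs_of_nonneg (hπ'.1 s a)]
      _ = d s * ∑ a, |π s a - π' s a| + |d s - d' s| := by
          rw [Finset.sum_add_distrib, ← Finset.mul_sum, ← Finset.mul_sum, hπ'.2, mul_one]
      _ ≤ _ := by
          have := mul_le_mul_of_nonneg_left (hc s) (hd.1 s)
          linarith
  refine (Finset.sum_le_sum fun s _ => hs s).trans ?_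
  rw [Finset.sum_add_distrib, ← Finset.sum_mul, hd.2, one_mul, l1]

theorem stmt3 {S A : Type*} [Fintype S] [Fintype A] [Nonempty S] [Nonempty A]
    (P : S → A → S → ℝ) (hP : IsTransition P)
    (K : ℕ) (hK : 1 ≤ K)
    (πs πs' : ℕ → S → A → ℝ)
    (hπs : ∀ k < K, IsPolicy (πs k)) (hπs' : ∀ k < K, IsPolicy (πs' k))
    (c : ℝ) (hc : ∀ k < K, ∀ s, ∑ a, |πs k s a - πs' k s a| ≤ c)
    (d d' : S → ℝ) (hd : IsDistribution d) (hd' : IsDistribution d')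
    (δ : ℝ) (hδ : l1 (fun s => d s - d' s) ≤ δ) :
    l1 (fun s => rollout P πs d K s - rollout P πs' d' K s) ≤ K * c + δ := by
  have key : ∀ k ≤ K, IsDistribution (rollout P πs d k) ∧
      l1 (fun s => rollout P πs d k s - rollout P πs' d' k s) ≤ k * c + δ := by
    intro k
    induction k with
    | zero => intro _; exact ⟨hd, by simpa [rollout] using hδ⟩
    | succ k ih =>
      intro hk
      obtain ⟨h1, h2⟩ := ih (by omega)
      refine ⟨step_dist P hP _ (hπs k hk) _ h1, ?_⟩
      have := step_l1 P hP (πs k) (πs' k) (hπs' k hk) c (hc k hk) _ (rollout P πs' d' k) h1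
      simp only [rollout]
      push_cast
      linarith
  exact (key K le_rfl).2
end

section
/- Let (π_t)_{t≥1} be a sequence of policies with ‖π_{t+1} − π_t‖_{1,∞} ≤ c_T for every t. Then for every state distribution d and all natural numbers t ≥ 1, n, K: ‖d(𝐏^{π_{t+n}})^K − d(𝐏^{π_t})^K‖₁ ≤ K·n·c_T. -/
open Finset

lemma l1_dApply_le {S A : Type*} [Fintype S] [Fintype A]
    (P : S → A → S → ℝ) (hP : IsTransition P) (w : S → ℝ) (ρ : S → A → ℝ) :
    l1 (dApply w (pmat P ρ)) ≤ ∑ s, |w s| * ∑ a, |ρ s a| := by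
  unfold l1 dApply pmat
  calc ∑ s', |∑ s, w s * ∑ a, ρ s a * P s a s'|
      ≤ ∑ s', ∑ s, |w s| * ∑ a, |ρ s a| * P s a s' := by
        refine Finset.sum_le_sum fun s' _ => (Finset.abs_sum_le_sum_abs _ _).trans ?_
        refine Finset.sum_le_sum fun s _ => ?_
        rw [abs_mul]
        refine mul_le_mul_of_nonneg_left ((Finset.abs_sum_le_sum_abs _ _).trans ?_) (abs_nonneg _)
        refine Finset.sum_le_sum fun a _ => ?_
        rw [abs_mul, abs_of_nonneg (hP.1 s a s')]
    _ = ∑ s, |w s| * ∑ a, |ρ s a| := by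
        rw [Finset.sum_comm]
        refine Finset.sum_congr rfl fun s _ => ?_
        rw [← Finset.mul_sum, Finset.sum_comm]
        congr 1
        refine Finset.sum_congr rfl fun a _ => ?_
        rw [← Finset.mul_sum, hP.2, mul_one]

lemma policy_abs_sum {S A : Type*} [Fintype A] {ρ : S → A → ℝ} (h : IsPolicy ρ) (s : S) :
    ∑ a, |ρ s a| = 1 := by
  rw [← h.2 s]
  exact Finset.sum_congr rfl fun a _ => abs_of_nonneg (h.1 s a)

lemma rollout_l1_le {S A : Type*} [Fintype S] [Fintype A]
    (P : S → A → S → ℝ) (hP : IsTransition P) (ρ : S → A → ℝ) (hρ : IsPolicy ρ)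
    (d : S → ℝ) (hd : IsDistribution d) (K : ℕ) :
    l1 (rollout P (fun _ => ρ) d K) ≤ 1 := by
  induction K with
  | zero =>
    rw [← hd.2]
    exact (Finset.sum_congr rfl fun s _ => abs_of_nonneg (hd.1 s)).le
  | succ k ih =>
    refine (l1_dApply_le P hP _ ρ).trans ?_
    simp only [policy_abs_sum hρ, mul_one]
    exact ih

lemma rollout_diff_le {S A : Type*} [Fintype S] [Fintype A]
    (P : S → A → S → ℝ) (hP : IsTransition P) (ρ σ : S → A → ℝ) (hρ : IsPolicy ρ)
    (hσ : IsPolicy σ) (δ : ℝ) (hδ0 : 0 ≤ δ) (hδ : ∀ s, ∑ a, |ρ s a - σ s a| ≤ δ)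
    (d : S → ℝ) (hd : IsDistribution d) (K : ℕ) :
    l1 (fun s => rollout P (fun _ => ρ) d K s - rollout P (fun _ => σ) d K s) ≤ K * δ := by
  induction K with
  | zero => simp [l1, rollout]
  | succ k ih =>
    have h1 := rollout_l1_le P hP ρ hρ d hd k
    simp only [rollout]
    generalize rollout P (fun _ => ρ) d k = u at *
    generalize rollout P (fun _ => σ) d k = v at *
    have key : ∀ s, dApply u (pmat P ρ) s - dApply v (pmat P σ) s
        = dApply (fun s => u s - v s) (pmat P σ) s
          + dApply u (pmat P (fun s a => ρ s a - σ s a)) s := by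
      intro s'
      simp only [dApply, pmat, sub_mul, mul_sub, Finset.sum_sub_distrib]
      ring
    have h2 := l1_dApply_le P hP (fun s => u s - v s) σ
    simp only [policy_abs_sum hσ, mul_one] at h2
    have h3 := l1_dApply_le P hP u (fun s a => ρ s a - σ s a)
    have h4 : ∑ s, |u s| * ∑ a, |ρ s a - σ s a| ≤ δ := by
      calc _ ≤ ∑ s, |u s| * δ :=
            Finset.sum_le_sum fun s _ => mul_le_mul_of_nonneg_left (hδ s) (abs_nonneg _)
        _ = l1 u * δ := by rw [← Finset.sum_mul]; rfl
        _ ≤ 1 * δ := mul_le_mul_of_nonneg_right h1 hδ0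
        _ = δ := one_mul δ
    have h5 : l1 (fun s => dApply u (pmat P ρ) s - dApply v (pmat P σ) s)
        ≤ l1 (dApply (fun s => u s - v s) (pmat P σ))
          + l1 (dApply u (pmat P (fun s a => ρ s a - σ s a))) := by
      unfold l1
      rw [← Finset.sum_add_distrib]
      refine Finset.sum_le_sum fun s _ => ?_
      beta_reduce
      rw [key]
      exact abs_add_le _ _
    have h6 : ∑ s, |u s - v s| ≤ k * δ := ih
    push_cast
    linarith

theorem stmt4 {S A : Type*} [Fintype S] [Fintype A] [Nonempty S] [Nonempty A]
    (P : S → A → S → ℝ) (hP : IsTransition P)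
    (π : ℕ → S → A → ℝ) (hπ : ∀ t, 1 ≤ t → IsPolicy (π t))
    (cT : ℝ) (hslow : ∀ t, 1 ≤ t → ∀ s, ∑ a, |π (t + 1) s a - π t s a| ≤ cT)
    (d : S → ℝ) (hd : IsDistribution d)
    (t n K : ℕ) (ht : 1 ≤ t) :
    l1 (fun s => rollout P (fun _ => π (t + n)) d K s - rollout P (fun _ => π t) d K s)
      ≤ K * n * cT := by
  obtain ⟨s0⟩ := ‹Nonempty S›
  have hc : 0 ≤ cT := (Finset.sum_nonneg fun a _ => abs_nonneg _).trans (hslow 1 le_rfl s0)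
  have hdist : ∀ m : ℕ, ∀ s, ∑ a, |π (t + m) s a - π t s a| ≤ m * cT := by
    intro m s
    induction m with
    | zero => simp
    | succ m ih =>
      have h := hslow (t + m) (by omega) s
      have h' : ∑ a, |π (t + (m + 1)) s a - π t s a|
          ≤ ∑ a, |π (t + m + 1) s a - π (t + m) s a| + ∑ a, |π (t + m) s a - π t s a| := by
        rw [← Finset.sum_add_distrib]
        exact Finset.sum_le_sum fun a _ => abs_sub_le _ _ _
      push_cast
      linarith
  have := rollout_diff_le P hP (π (t + n)) (π t) (hπ _ (by omega)) (hπ _ ht) (n * cT)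
    (by positivity) (hdist n) d hd K
  rwa [← mul_assoc] at this
end

section
/- Let (π_t)_{t≥1} be a sequence of policies with ‖π_{t+1} − π_t‖_{1,∞} ≤ c_T for every t. Then for every state distribution d and all natural numbers t ≥ 1 and K: ‖d(𝐏^{π_t}𝐏^{π_{t+1}}⋯𝐏^{π_{t+K−1}}) − d(𝐏^{π_t})^K‖₁ ≤ K²·c_T. -/
open Finset

theorem aux_l1 {S A : Type*} [Fintype S] [Fintype A]
    (P : S → A → S → ℝ) (hP : IsTransition P) (f : S → A → ℝ) :
    l1 (fun s' => ∑ s, ∑ a, f s a * P s a s') ≤ ∑ s, ∑ a, |f s a| := by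
  unfold l1
  calc ∑ s', |∑ s, ∑ a, f s a * P s a s'|
      ≤ ∑ s', ∑ s, ∑ a, |f s a| * P s a s' := by
        refine Finset.sum_le_sum fun s' _ => ?_
        refine (Finset.abs_sum_le_sum_abs _ _).trans (Finset.sum_le_sum fun s _ => ?_)
        refine (Finset.abs_sum_le_sum_abs _ _).trans (Finset.sum_le_sum fun a _ => ?_)
        rw [abs_mul, abs_of_nonneg (hP.1 s a s')]
    _ = ∑ s, ∑ a, |f s a| := by
        rw [Finset.sum_comm]
        refine Finset.sum_congr rfl fun s _ => ?_
        rw [Finset.sum_comm]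
        refine Finset.sum_congr rfl fun a _ => ?_
        rw [← Finset.mul_sum, hP.2, mul_one]

theorem aux_apply {S A : Type*} [Fintype S] [Fintype A]
    (P : S → A → S → ℝ) (x : S → ℝ) (q : S → A → ℝ) (s' : S) :
    dApply x (pmat P q) s' = ∑ s, ∑ a, (x s * q s a) * P s a s' := by
  simp only [dApply, pmat, Finset.mul_sum, mul_assoc]

theorem aux_mass {S A : Type*} [Fintype S] [Fintype A]
    (P : S → A → S → ℝ) (hP : IsTransition P) (x : S → ℝ) (q : S → A → ℝ)
    (hq : IsPolicy q) : l1 (dApply x (pmat P q)) ≤ l1 x := by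
  have h := aux_l1 P hP (fun s a => x s * q s a)
  have e : dApply x (pmat P q) = fun s' => ∑ s, ∑ a, (x s * q s a) * P s a s' :=
    funext (aux_apply P x q)
  rw [e]
  refine h.trans (le_of_eq ?_)
  refine Finset.sum_congr rfl fun s _ => ?_
  simp only [abs_mul, abs_of_nonneg (hq.1 _ _)]
  rw [← Finset.mul_sum, hq.2, mul_one]

theorem aux_step {S A : Type*} [Fintype S] [Fintype A]
    (P : S → A → S → ℝ) (hP : IsTransition P) (x y : S → ℝ) (p q : S → A → ℝ)
    (hp : IsPolicy p) (c : ℝ) (hc : 0 ≤ c) (hpq : ∀ s, ∑ a, |q s a - p s a| ≤ c)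
    (hx : l1 x ≤ 1) :
    l1 (fun s => dApply x (pmat P q) s - dApply y (pmat P p) s)
      ≤ l1 (fun s => x s - y s) + c := by
  have e : (fun s => dApply x (pmat P q) s - dApply y (pmat P p) s)
      = fun s' => ∑ s, ∑ a, (x s * q s a - y s * p s a) * P s a s' := by
    funext s'
    simp only [aux_apply, sub_mul, Finset.sum_sub_distrib]
  rw [e]
  refine (aux_l1 P hP (fun s a => x s * q s a - y s * p s a)).trans ?_
  have h1 : ∀ s, ∑ a, |x s * q s a - y s * p s a| ≤ |x s - y s| + |x s| * c := by
    intro s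
    calc ∑ a, |x s * q s a - y s * p s a|
        ≤ ∑ a, (|x s - y s| * p s a + |x s| * |q s a - p s a|) := by
          refine Finset.sum_le_sum fun a _ => ?_
          have : x s * q s a - y s * p s a
              = (x s - y s) * p s a + x s * (q s a - p s a) := by ring
          rw [this]
          refine (abs_add_le _ _).trans ?_
          rw [abs_mul, abs_mul, abs_of_nonneg (hp.1 s a)]
      _ = |x s - y s| + |x s| * ∑ a, |q s a - p s a| := by
          rw [Finset.sum_add_distrib, ← Finset.mul_sum, ← Finset.mul_sum, hp.2, mul_one]
      _ ≤ _ := by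
          have := mul_le_mul_of_nonneg_left (hpq s) (abs_nonneg (x s))
          linarith
  refine (Finset.sum_le_sum fun s _ => h1 s).trans ?_
  rw [Finset.sum_add_distrib, ← Finset.sum_mul]
  have := mul_le_mul_of_nonneg_right hx hc
  unfold l1 at *
  linarith

theorem stmt5 {S A : Type*} [Fintype S] [Fintype A] [Nonempty S] [Nonempty A]
    (P : S → A → S → ℝ) (hP : IsTransition P)
    (π : ℕ → S → A → ℝ) (hπ : ∀ t, 1 ≤ t → IsPolicy (π t))
    (cT : ℝ) (hslow : ∀ t, 1 ≤ t → ∀ s, ∑ a, |π (t + 1) s a - π t s a| ≤ cT)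
    (d : S → ℝ) (hd : IsDistribution d)
    (t K : ℕ) (ht : 1 ≤ t) :
    l1 (fun s => rollout P (fun k => π (t + k)) d K s - rollout P (fun _ => π t) d K s)
      ≤ (K : ℝ) ^ 2 * cT := by
  have hc : 0 ≤ cT := by
    obtain ⟨s⟩ := ‹Nonempty S›
    exact (Finset.sum_nonneg fun a _ => abs_nonneg _).trans (hslow 1 le_rfl s)
  have hdrift : ∀ k : ℕ, ∀ s, ∑ a, |π (t + k) s a - π t s a| ≤ k * cT := by
    intro k s
    induction k with
    | zero => simp
    | succ k ih =>
      have h := hslow (t + k) (by omega) s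
      have h2 : ∑ a, |π (t + (k + 1)) s a - π t s a|
          ≤ ∑ a, |π (t + k + 1) s a - π (t + k) s a| + ∑ a, |π (t + k) s a - π t s a| := by
        rw [← Finset.sum_add_distrib]
        exact Finset.sum_le_sum fun a _ => abs_sub_le _ _ _
      push_cast
      linarith
  have hmass : ∀ k : ℕ, l1 (rollout P (fun k => π (t + k)) d k) ≤ 1 := by
    intro k
    induction k with
    | zero =>
      simp only [rollout, l1, abs_of_nonneg (hd.1 _), hd.2, le_refl]
    | succ k ih => exact (aux_mass P hP _ _ (hπ (t + k) (by omega))).trans ih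
  induction K with
  | zero => simp [rollout, l1]
  | succ k ih =>
    have h := aux_step P hP (rollout P (fun k => π (t + k)) d k)
      (rollout P (fun _ => π t) d k) (π t) (π (t + k)) (hπ t ht) (k * cT)
      (by positivity) (hdrift k) (hmass k)
    simp only [rollout]
    refine h.trans ?_
    have hk : (0 : ℝ) ≤ (k : ℝ) * cT := by positivity
    push_cast
    nlinarith
end

section
/- Let (π_t)_{t≥1} be a sequence of policies with ‖π_{t+1} − π_t‖_{1,∞} ≤ c_T for every t. Then for every state distribution d and all natural numbers t ≥ 1, n, K: ‖d(𝐏^{π_{t+n}}𝐏^{π_{t+n+1}}⋯𝐏^{π_{t+n+K−1}}) − d(𝐏^{π_t}𝐏^{π_{t+1}}⋯𝐏^{π_{t+K−1}})‖₁ ≤ K·n·c_T. -/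
open Finset

/-- Moving the absolute value inside a mixture over actions. -/
lemma aux_kernel {S A : Type*} [Fintype S] [Fintype A]
    (P : S → A → S → ℝ) (hP : IsTransition P) (f : A → ℝ) (s : S) :
    ∑ s', |∑ a, f a * P s a s'| ≤ ∑ a, |f a| := by
  calc ∑ s', |∑ a, f a * P s a s'| ≤ ∑ s', ∑ a, |f a| * P s a s' := by
        refine Finset.sum_le_sum fun s' _ => (Finset.abs_sum_le_sum_abs _ _).trans ?_
        refine Finset.sum_le_sum fun a _ => ?_
        rw [abs_mul, abs_of_nonneg (hP.1 s a s')]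
    _ = ∑ a, |f a| := by
        rw [Finset.sum_comm]
        refine Finset.sum_congr rfl fun a _ => ?_
        rw [← Finset.mul_sum, hP.2, mul_one]

/-- A bound on the rows of a matrix bounds its action in the l1 norm. -/
lemma aux_apply_s6 {S : Type*} [Fintype S] (w : S → ℝ) (M : S → S → ℝ) (C : ℝ)
    (hM : ∀ s, ∑ s', |M s s'| ≤ C) : l1 (dApply w M) ≤ l1 w * C := by
  unfold l1 dApply
  calc ∑ s', |∑ s, w s * M s s'| ≤ ∑ s', ∑ s, |w s| * |M s s'| := by
        refine Finset.sum_le_sum fun s' _ => (Finset.abs_sum_le_sum_abs _ _).trans ?_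
        exact Finset.sum_le_sum fun s _ => (abs_mul _ _).le
    _ = ∑ s, |w s| * ∑ s', |M s s'| := by
        rw [Finset.sum_comm]
        exact Finset.sum_congr rfl fun s _ => (Finset.mul_sum _ _ _).symm
    _ ≤ ∑ s, |w s| * C :=
        Finset.sum_le_sum fun s _ => mul_le_mul_of_nonneg_left (hM s) (abs_nonneg _)
    _ = (∑ s, |w s|) * C := (Finset.sum_mul _ _ _).symm

lemma aux_pmat {S A : Type*} [Fintype S] [Fintype A]
    (P : S → A → S → ℝ) (hP : IsTransition P) (p : S → A → ℝ) (hp : IsPolicy p) (s : S) :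
    ∑ s', |pmat P p s s'| ≤ 1 := by
  refine (aux_kernel P hP (p s) s).trans ?_
  rw [← hp.2 s]
  exact Finset.sum_le_sum fun a _ => (abs_of_nonneg (hp.1 s a)).le

lemma aux_l1_nonneg {S : Type*} [Fintype S] (v : S → ℝ) : 0 ≤ l1 v :=
  Finset.sum_nonneg fun _ _ => abs_nonneg _

lemma aux_rollout {S A : Type*} [Fintype S] [Fintype A]
    (P : S → A → S → ℝ) (hP : IsTransition P) (p : ℕ → S → A → ℝ) (hp : ∀ k, IsPolicy (p k))
    (d : S → ℝ) (hd : IsDistribution d) (K : ℕ) : l1 (rollout P p d K) ≤ 1 := by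
  induction K with
  | zero =>
    rw [← hd.2]
    exact Finset.sum_le_sum fun s _ => (abs_of_nonneg (hd.1 s)).le
  | succ k ih =>
    have := aux_apply_s6 (rollout P p d k) (pmat P (p k)) 1 (aux_pmat P hP _ (hp k))
    rw [mul_one] at this
    exact this.trans ih

lemma aux_main {S A : Type*} [Fintype S] [Fintype A]
    (P : S → A → S → ℝ) (hP : IsTransition P) (p q : ℕ → S → A → ℝ)
    (hp : ∀ k, IsPolicy (p k)) (hq : ∀ k, IsPolicy (q k)) (C : ℝ) (hC : 0 ≤ C)
    (h : ∀ k s, ∑ a, |p k s a - q k s a| ≤ C)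
    (d : S → ℝ) (hd : IsDistribution d) (K : ℕ) :
    l1 (fun s => rollout P p d K s - rollout P q d K s) ≤ K * C := by
  induction K with
  | zero => simp [l1, rollout]
  | succ k ih =>
    set u := rollout P p d k with hu
    set v := rollout P q d k with hv
    have e : (fun s => rollout P p d (k+1) s - rollout P q d (k+1) s) = fun s =>
        dApply (fun s => u s - v s) (pmat P (p k)) s +
        dApply v (fun s s' => ∑ a, (p k s a - q k s a) * P s a s') s := by
      funext s
      simp only [rollout, dApply, pmat, sub_mul, mul_sub, Finset.sum_sub_distrib, ← hu, ← hv]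
      ring
    have h1 := aux_apply_s6 (fun s => u s - v s) (pmat P (p k)) 1 (aux_pmat P hP _ (hp k))
    have h2 := aux_apply_s6 v (fun s s' => ∑ a, (p k s a - q k s a) * P s a s') C
      (fun s => (aux_kernel P hP (fun a => p k s a - q k s a) s).trans (h k s))
    have h3 := mul_le_mul_of_nonneg_right (aux_rollout P hP q hq d hd k) hC
    rw [e]
    have h4 : ∀ x y : S → ℝ, l1 (fun s => x s + y s) ≤ l1 x + l1 y := fun x y => by
      unfold l1
      rw [← Finset.sum_add_distrib]
      exact Finset.sum_le_sum fun s _ => abs_add_le _ _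
    refine (h4 _ _).trans ?_
    push_cast
    linarith

theorem stmt6 {S A : Type*} [Fintype S] [Fintype A] [Nonempty S] [Nonempty A]
    (P : S → A → S → ℝ) (hP : IsTransition P)
    (π : ℕ → S → A → ℝ) (hπ : ∀ t, 1 ≤ t → IsPolicy (π t))
    (cT : ℝ) (hslow : ∀ t, 1 ≤ t → ∀ s, ∑ a, |π (t + 1) s a - π t s a| ≤ cT)
    (d : S → ℝ) (hd : IsDistribution d)
    (t n K : ℕ) (ht : 1 ≤ t) :
    l1 (fun s => rollout P (fun k => π (t + n + k)) d K s
          - rollout P (fun k => π (t + k)) d K s)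
      ≤ K * n * cT := by
  have hc : 0 ≤ cT := by
    obtain ⟨s⟩ := ‹Nonempty S›
    exact (Finset.sum_nonneg fun _ _ => abs_nonneg _).trans (hslow 1 le_rfl s)
  have hn : ∀ n t, 1 ≤ t → ∀ s, ∑ a, |π (t + n) s a - π t s a| ≤ n * cT := by
    intro n
    induction n with
    | zero => intro t _ s; simp
    | succ n ih =>
      intro t ht s
      have h1 := ih t ht s
      have h2 := hslow (t + n) (by omega) s
      have h3 : ∑ a, |π (t + (n + 1)) s a - π t s a| ≤
          ∑ a, |π (t + n + 1) s a - π (t + n) s a| + ∑ a, |π (t + n) s a - π t s a| := by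
        rw [← Finset.sum_add_distrib]
        exact Finset.sum_le_sum fun a _ => abs_sub_le _ _ _
      push_cast
      linarith
  rw [mul_assoc]
  refine aux_main P hP _ _ (fun k => hπ _ (by omega)) (fun k => hπ _ (by omega)) _
    (by positivity) (fun k s => ?_) d hd K
  have := hn n (t + k) (by omega) s
  rwa [show t + k + n = t + n + k by omega] at this
end

section
/- Let (π_t)_{t≥1} be a sequence of policies with ‖π_{t+1} − π_t‖_{1,∞} ≤ c_T for every t, let T ≥ 1 be a real number, and let H be a natural number with γ^H ≤ (1−γ)/√T. Then for every policy π⋆ and every state s ∈ 𝒮: |Σ_{t=1}^T Σ_a (π⋆(a|s) − π_t(a|s))·Ū_t(s,a) − Σ_{t=1}^T Σ_a (π⋆(a|s) − π_t(a|s))·Q^{π_t}(s,a)| ≤ 2H(S + HA)·c_T·T/(1−γ) + 2√T. -/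
open Finset

/-- Expected one-step reward of a policy: r^π(s) = Σ_a π(a|s) r(s,a). -/
def rpol {S A : Type*} [Fintype A] (r : S → A → ℝ) (π : S → A → ℝ) : S → ℝ :=
  fun s => ∑ a, π s a * r s a

/-- The action-value function
`Q^π(s,a) = r(s,a) + Σ_{k=1}^∞ γ^k Σ_{s'} (𝐏(s,a,·)(𝐏^π)^{k−1})(s') r^π(s')`. -/
noncomputable def Qval {S A : Type*} [Fintype S] [Fintype A] (γ : ℝ)
    (P : S → A → S → ℝ) (r : S → A → ℝ) (π : S → A → ℝ) (s : S) (a : A) : ℝ :=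
  r s a + ∑' k : ℕ, γ ^ (k + 1) *
    ∑ s', rollout P (fun _ => π) (fun s'' => P s a s'') k s' * rpol r π s'

/-- The finite-horizon non-stationary value
`Ū_t(s,a) = r(s,a) + Σ_{k=1}^H γ^k Σ_{s'} d_k(s') r^{π_{t+k}}(s')`, where
`d_1 = 𝐏(s,a,·)` and `d_{k+1} = d_k 𝐏^{π_{t+k}}`. -/
noncomputable def Ubar {S A : Type*} [Fintype S] [Fintype A] (γ : ℝ)
    (P : S → A → S → ℝ) (r : S → A → ℝ) (π : ℕ → S → A → ℝ) (t H : ℕ)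
    (s : S) (a : A) : ℝ :=
  r s a + ∑ k ∈ Finset.range H, γ ^ (k + 1) *
    ∑ s', rollout P (fun j => π (t + 1 + j)) (fun s'' => P s a s'') k s' *
      rpol r (π (t + 1 + k)) s'

theorem aux_pmat_nonneg {S A : Type*} [Fintype S] [Fintype A] {P : S → A → S → ℝ}
    (hP : IsTransition P) {p : S → A → ℝ} (hp : IsPolicy p) (s s' : S) : 0 ≤ pmat P p s s' :=
  Finset.sum_nonneg fun a _ => mul_nonneg (hp.1 s a) (hP.1 s a s')

theorem aux_pmat_sum {S A : Type*} [Fintype S] [Fintype A] {P : S → A → S → ℝ}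
    (hP : IsTransition P) {p : S → A → ℝ} (hp : IsPolicy p) (s : S) :
    ∑ s', pmat P p s s' = 1 := by
  unfold pmat
  rw [Finset.sum_comm]
  simp [← Finset.mul_sum, hP.2, hp.2]

theorem aux_pmat_diff {S A : Type*} [Fintype S] [Fintype A] {P : S → A → S → ℝ}
    (hP : IsTransition P) (p q : S → A → ℝ) (s : S) :
    ∑ s', |pmat P p s s' - pmat P q s s'| ≤ ∑ a, |p s a - q s a| := by
  calc ∑ s', |pmat P p s s' - pmat P q s s'|
      ≤ ∑ s', ∑ a, |p s a - q s a| * P s a s' := by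
        refine Finset.sum_le_sum fun s' _ => ?_
        unfold pmat
        rw [← Finset.sum_sub_distrib]
        refine (Finset.abs_sum_le_sum_abs _ _).trans (le_of_eq ?_)
        refine Finset.sum_congr rfl fun a _ => ?_
        rw [← sub_mul, abs_mul, abs_of_nonneg (hP.1 s a s')]
    _ = ∑ a, |p s a - q s a| := by
        rw [Finset.sum_comm]
        simp [← Finset.mul_sum, hP.2]

theorem aux_rollout_dist {S A : Type*} [Fintype S] [Fintype A] {P : S → A → S → ℝ}
    (hP : IsTransition P) {ps : ℕ → S → A → ℝ} (hps : ∀ j, IsPolicy (ps j)) {d : S → ℝ}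
    (hd : IsDistribution d) (k : ℕ) : IsDistribution (rollout P ps d k) := by
  induction k with
  | zero => exact hd
  | succ k ih =>
    refine ⟨fun s' => Finset.sum_nonneg fun s _ =>
      mul_nonneg (ih.1 s) (aux_pmat_nonneg hP (hps k) s s'), ?_⟩
    simp only [rollout, dApply]
    rw [Finset.sum_comm]
    simp [← Finset.mul_sum, aux_pmat_sum hP (hps k), ih.2]

theorem aux_rollout_diff {S A : Type*} [Fintype S] [Fintype A] {P : S → A → S → ℝ}
    (hP : IsTransition P) {ps : ℕ → S → A → ℝ} (hps : ∀ j, IsPolicy (ps j))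
    {p : S → A → ℝ} (hp : IsPolicy p) {d : S → ℝ} (hd : IsDistribution d) (B : ℝ) (k : ℕ)
    (hB : ∀ j < k, ∀ s, ∑ a, |ps j s a - p s a| ≤ B) :
    ∑ s, |rollout P ps d k s - rollout P (fun _ => p) d k s| ≤ k * B := by
  induction k with
  | zero => simp [rollout]
  | succ k ih =>
    have ih' := ih fun j hj => hB j (by omega)
    have hdist := aux_rollout_dist hP (ps := fun _ => p) (fun _ => hp) hd k
    simp only [rollout, dApply]
    set u := rollout P ps d k
    set v := rollout P (fun _ => p) d k
    calc ∑ s', |∑ s, u s * pmat P (ps k) s s' - ∑ s, v s * pmat P p s s'|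
        ≤ ∑ s', ∑ s, (|u s - v s| * pmat P (ps k) s s'
            + v s * |pmat P (ps k) s s' - pmat P p s s'|) := by
          refine Finset.sum_le_sum fun s' _ => ?_
          rw [← Finset.sum_sub_distrib]
          refine (Finset.abs_sum_le_sum_abs _ _).trans (Finset.sum_le_sum fun s _ => ?_)
          have e : u s * pmat P (ps k) s s' - v s * pmat P p s s'
            = (u s - v s) * pmat P (ps k) s s' + v s * (pmat P (ps k) s s' - pmat P p s s') := by
            ring
          rw [e]
          refine (abs_add_le _ _).trans (le_of_eq ?_)
          rw [abs_mul, abs_mul, abs_of_nonneg (aux_pmat_nonneg hP (hps k) s s'),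
            abs_of_nonneg (hdist.1 s)]
      _ = ∑ s, (|u s - v s| + v s * ∑ s', |pmat P (ps k) s s' - pmat P p s s'|) := by
          rw [Finset.sum_comm]
          refine Finset.sum_congr rfl fun s _ => ?_
          rw [Finset.sum_add_distrib, ← Finset.mul_sum, ← Finset.mul_sum,
            aux_pmat_sum hP (hps k), mul_one]
      _ ≤ ∑ s, (|u s - v s| + v s * B) := by
          refine Finset.sum_le_sum fun s _ => ?_
          have h1 := (aux_pmat_diff hP (ps k) p s).trans (hB k (by omega) s)
          have h2 := mul_le_mul_of_nonneg_left h1 (hdist.1 s)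
          linarith
      _ ≤ ((k + 1 : ℕ) : ℝ) * B := by
          rw [Finset.sum_add_distrib, ← Finset.sum_mul, hdist.2]
          push_cast
          linarith

theorem aux_rpol_bd {S A : Type*} [Fintype A] {r : S → A → ℝ}
    (hr : ∀ s a, 0 ≤ r s a ∧ r s a ≤ 1) {p : S → A → ℝ} (hp : IsPolicy p) (s : S) :
    0 ≤ rpol r p s ∧ rpol r p s ≤ 1 := by
  refine ⟨Finset.sum_nonneg fun a _ => mul_nonneg (hp.1 s a) (hr s a).1, ?_⟩
  rw [← hp.2 s]
  exact Finset.sum_le_sum fun a _ => mul_le_of_le_one_right (hp.1 s a) (hr s a).2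

theorem aux_rpol_diff {S A : Type*} [Fintype A] {r : S → A → ℝ}
    (hr : ∀ s a, 0 ≤ r s a ∧ r s a ≤ 1) (p q : S → A → ℝ) (s : S) :
    |rpol r p s - rpol r q s| ≤ ∑ a, |p s a - q s a| := by
  unfold rpol
  rw [← Finset.sum_sub_distrib]
  refine (Finset.abs_sum_le_sum_abs _ _).trans (Finset.sum_le_sum fun a _ => ?_)
  rw [← sub_mul, abs_mul, abs_of_nonneg (hr s a).1]
  exact mul_le_of_le_one_right (abs_nonneg _) (hr s a).2

theorem aux_term_diff {S : Type*} [Fintype S] {u v f g : S → ℝ} {B C : ℝ}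
    (hv : IsDistribution v) (hf : ∀ s, 0 ≤ f s ∧ f s ≤ 1)
    (huv : ∑ s, |u s - v s| ≤ C) (hfg : ∀ s, |f s - g s| ≤ B) :
    |∑ s, u s * f s - ∑ s, v s * g s| ≤ C + B := by
  rw [← Finset.sum_sub_distrib]
  calc |∑ s, (u s * f s - v s * g s)| ≤ ∑ s, (|u s - v s| + v s * B) := by
        refine (Finset.abs_sum_le_sum_abs _ _).trans (Finset.sum_le_sum fun s _ => ?_)
        have e : u s * f s - v s * g s = (u s - v s) * f s + v s * (f s - g s) := by ring
        rw [e]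
        refine (abs_add_le _ _).trans ?_
        rw [abs_mul, abs_mul, abs_of_nonneg (hf s).1, abs_of_nonneg (hv.1 s)]
        exact add_le_add (mul_le_of_le_one_right (abs_nonneg _) (hf s).2)
          (mul_le_mul_of_nonneg_left (hfg s) (hv.1 s))
    _ ≤ C + B := by
        rw [Finset.sum_add_distrib, ← Finset.sum_mul, hv.2]
        linarith

theorem aux_drift {S A : Type*} [Fintype A] {π : ℕ → S → A → ℝ} {cT : ℝ}
    (hslow : ∀ t, 1 ≤ t → ∀ s, ∑ a, |π (t + 1) s a - π t s a| ≤ cT) (t : ℕ) (ht : 1 ≤ t)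
    (n : ℕ) (s : S) : ∑ a, |π (t + n) s a - π t s a| ≤ n * cT := by
  induction n with
  | zero => simp
  | succ n ih =>
    calc ∑ a, |π (t + (n + 1)) s a - π t s a|
        ≤ ∑ a, (|π (t + n + 1) s a - π (t + n) s a| + |π (t + n) s a - π t s a|) :=
          Finset.sum_le_sum fun a _ => abs_sub_le _ _ _
      _ ≤ ((n + 1 : ℕ) : ℝ) * cT := by
          rw [Finset.sum_add_distrib]
          have := hslow (t + n) (by omega) s
          push_cast
          linarith

theorem aux_series {γ : ℝ} (hγ0 : 0 < γ) (hγ1 : γ < 1) {f g : ℕ → ℝ} {H : ℕ} {D : ℝ}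
    (hD : 0 ≤ D) (hg : ∀ k, 0 ≤ g k ∧ g k ≤ 1) (hfg : ∀ k < H, |f k - g k| ≤ D) :
    |∑ k ∈ Finset.range H, γ ^ (k + 1) * f k - ∑' k : ℕ, γ ^ (k + 1) * g k|
      ≤ D / (1 - γ) + γ ^ H / (1 - γ) := by
  have h1 : 0 < 1 - γ := by linarith
  have hgeo := summable_geometric_of_lt_one hγ0.le hγ1
  have hle : ∀ k : ℕ, γ ^ (k + 1) * g k ≤ γ ^ k := fun k =>
    (mul_le_of_le_one_right (by positivity) (hg k).2).trans
      (pow_le_pow_of_le_one hγ0.le hγ1.le (by omega))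
  have hnn : ∀ k : ℕ, 0 ≤ γ ^ (k + 1) * g k := fun k => mul_nonneg (by positivity) (hg k).1
  have hs : Summable fun k : ℕ => γ ^ (k + 1) * g k := Summable.of_nonneg_of_le hnn hle hgeo
  rw [← hs.sum_add_tsum_nat_add H, ← sub_sub, ← Finset.sum_sub_distrib]
  refine (abs_sub _ _).trans (add_le_add ?_ ?_)
  · calc |∑ k ∈ Finset.range H, (γ ^ (k + 1) * f k - γ ^ (k + 1) * g k)|
        ≤ ∑ k ∈ Finset.range H, γ ^ k * D := by
          refine (Finset.abs_sum_le_sum_abs _ _).trans (Finset.sum_le_sum fun k hk => ?_)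
          rw [← mul_sub, abs_mul, abs_of_nonneg (by positivity : 0 ≤ γ ^ (k + 1))]
          exact mul_le_mul (pow_le_pow_of_le_one hγ0.le hγ1.le (by omega))
            (hfg k (Finset.mem_range.1 hk)) (abs_nonneg _) (by positivity)
      _ ≤ (∑' k : ℕ, γ ^ k) * D := by
          rw [← Finset.sum_mul]
          exact mul_le_mul_of_nonneg_right
            (hgeo.sum_le_tsum _ fun k _ => by positivity) hD
      _ = D / (1 - γ) := by
          rw [tsum_geometric_of_lt_one hγ0.le hγ1]
          ring
  · rw [abs_of_nonneg (tsum_nonneg fun k => hnn _)]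
    calc ∑' k : ℕ, γ ^ (k + H + 1) * g (k + H) ≤ ∑' k : ℕ, γ ^ k * γ ^ H := by
          refine Summable.tsum_le_tsum (fun k => ?_) ((summable_nat_add_iff H).2 hs)
            (hgeo.mul_right _)
          rw [← pow_add]
          exact hle _
      _ = γ ^ H / (1 - γ) := by
          rw [tsum_mul_right, tsum_geometric_of_lt_one hγ0.le hγ1]
          ring

theorem stmt9 {S A : Type*} [Fintype S] [Fintype A] [Nonempty S] [Nonempty A]
    (γ : ℝ) (hγ0 : 0 < γ) (hγ1 : γ < 1)
    (P : S → A → S → ℝ) (hP : IsTransition P)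
    (r : S → A → ℝ) (hr : ∀ s a, 0 ≤ r s a ∧ r s a ≤ 1)
    (π : ℕ → S → A → ℝ) (hπ : ∀ t, 1 ≤ t → IsPolicy (π t))
    (cT : ℝ) (hslow : ∀ t, 1 ≤ t → ∀ s, ∑ a, |π (t + 1) s a - π t s a| ≤ cT)
    (T : ℕ) (hT : 1 ≤ T) (H : ℕ) (hH : γ ^ H ≤ (1 - γ) / Real.sqrt T)
    (πstar : S → A → ℝ) (hπstar : IsPolicy πstar) (s : S) :
    |(∑ t ∈ Finset.Icc 1 T, ∑ a, (πstar s a - π t s a) * Ubar γ P r π t H s a)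
      - ∑ t ∈ Finset.Icc 1 T, ∑ a, (πstar s a - π t s a) * Qval γ P r (π t) s a|
      ≤ 2 * (H : ℝ) * ((Fintype.card S : ℝ) + (H : ℝ) * Fintype.card A) * cT * T / (1 - γ)
        + 2 * Real.sqrt T := by
  have hS : (1 : ℝ) ≤ Fintype.card S := by exact_mod_cast Fintype.card_pos (α := S)
  have hA : (1 : ℝ) ≤ Fintype.card A := by exact_mod_cast Fintype.card_pos (α := A)
  have hc : 0 ≤ cT := (Finset.sum_nonneg fun a _ => abs_nonneg _).trans (hslow 1 le_rfl s)
  have h1 : 0 < 1 - γ := by linarith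
  have hH0 : (0 : ℝ) ≤ H := Nat.cast_nonneg H
  have hT1 : (1 : ℝ) ≤ T := by exact_mod_cast hT
  have hsq : 0 < Real.sqrt T := Real.sqrt_pos.2 (by linarith)
  set D : ℝ := H * (H * cT) with hDdef
  have hD : 0 ≤ D := by positivity
  have key : ∀ t, 1 ≤ t → ∀ a, |Ubar γ P r π t H s a - Qval γ P r (π t) s a|
      ≤ D / (1 - γ) + γ ^ H / (1 - γ) := by
    intro t ht a
    unfold Ubar Qval
    rw [add_sub_add_left_eq_sub]
    have hd : IsDistribution (fun s'' => P s a s'') := ⟨hP.1 s a, hP.2 s a⟩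
    have hps : ∀ j, IsPolicy (π (t + 1 + j)) := fun j => hπ _ (by omega)
    have hv := fun k => aux_rollout_dist hP (ps := fun _ => π t) (fun _ => hπ t ht) hd k
    have hdr : ∀ j < H, ∀ s', ∑ a, |π (t + 1 + j) s' a - π t s' a| ≤ H * cT := by
      intro j hj s'
      have h := aux_drift hslow t ht (1 + j) s'
      rw [← add_assoc] at h
      refine h.trans (mul_le_mul_of_nonneg_right ?_ hc)
      exact_mod_cast (by omega : 1 + j ≤ H)
    refine aux_series hγ0 hγ1 hD (fun k => ⟨?_, ?_⟩) (fun k hk => ?_)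
    · exact Finset.sum_nonneg fun s' _ =>
        mul_nonneg ((hv k).1 s') (aux_rpol_bd hr (hπ t ht) s').1
    · rw [← (hv k).2]
      exact Finset.sum_le_sum fun s' _ =>
        mul_le_of_le_one_right ((hv k).1 s') (aux_rpol_bd hr (hπ t ht) s').2
    · have h2 := aux_term_diff (hv k) (fun s' => aux_rpol_bd hr (hps k) s')
        (aux_rollout_diff hP hps (hπ t ht) hd (H * cT) k
          fun j hj s' => hdr j (by omega) s')
        (fun s' => (aux_rpol_diff hr _ (π t) s').trans (hdr k hk s'))
      refine h2.trans ?_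
      have h3 : (k : ℝ) + 1 ≤ H := by exact_mod_cast hk
      have h4 : 0 ≤ H * cT := by positivity
      have h5 := mul_le_mul_of_nonneg_right h3 h4
      rw [hDdef]
      linarith
  set E : ℝ := D / (1 - γ) + γ ^ H / (1 - γ) with hE
  have hE0 : 0 ≤ E := by positivity
  have step : ∀ t ∈ Finset.Icc 1 T, |∑ a, (πstar s a - π t s a) * Ubar γ P r π t H s a
      - ∑ a, (πstar s a - π t s a) * Qval γ P r (π t) s a| ≤ 2 * E := by
    intro t ht
    have ht1 := (Finset.mem_Icc.1 ht).1
    rw [← Finset.sum_sub_distrib]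
    calc |∑ a, ((πstar s a - π t s a) * Ubar γ P r π t H s a
          - (πstar s a - π t s a) * Qval γ P r (π t) s a)|
        ≤ ∑ a, (πstar s a + π t s a) * E := by
          refine (Finset.abs_sum_le_sum_abs _ _).trans (Finset.sum_le_sum fun a _ => ?_)
          have p1 := hπstar.1 s a
          have p2 := (hπ t ht1).1 s a
          rw [← mul_sub, abs_mul]
          refine mul_le_mul ?_ (key t ht1 a) (abs_nonneg _) (by linarith)
          rw [abs_le]
          constructor <;> linarith
      _ = 2 * E := by
          rw [← Finset.sum_mul, Finset.sum_add_distrib, hπstar.2, (hπ t ht1).2]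
          norm_num
  rw [← Finset.sum_sub_distrib]
  refine (Finset.abs_sum_le_sum_abs _ _).trans ((Finset.sum_le_sum step).trans ?_)
  rw [Finset.sum_const, Nat.card_Icc, nsmul_eq_mul, Nat.add_sub_cancel]
  have hγH : γ ^ H / (1 - γ) ≤ 1 / Real.sqrt T := by
    rw [div_le_iff₀ h1]
    refine hH.trans (le_of_eq ?_)
    ring
  have hTs : (T : ℝ) * (1 / Real.sqrt T) = Real.sqrt T := by
    rw [mul_one_div, Real.div_sqrt]
  have hDle : D ≤ H * ((Fintype.card S : ℝ) + H * Fintype.card A) * cT := by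
    have : (H : ℝ) ≤ (Fintype.card S : ℝ) + H * Fintype.card A := by nlinarith
    have h6 := mul_le_mul_of_nonneg_right (mul_le_mul_of_nonneg_left this hH0) hc
    rw [hDdef]
    linarith
  have hT0 : (0 : ℝ) ≤ T := by linarith
  have a1 := mul_le_mul_of_nonneg_left hγH hT0
  have a2 := mul_le_mul_of_nonneg_left (div_le_div_of_nonneg_right hDle h1.le) hT0
  rw [hTs] at a1
  calc (T : ℝ) * (2 * E) = 2 * (T * (D / (1 - γ))) + 2 * (T * (γ ^ H / (1 - γ))) := by
        rw [hE]; ring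
    _ ≤ 2 * (T * (H * ((Fintype.card S : ℝ) + H * Fintype.card A) * cT / (1 - γ)))
        + 2 * Real.sqrt T := by linarith
    _ = _ := by ring
end

section
/- (Performance difference lemma) For all policies π and π' and every state s₀ ∈ 𝒮: V^{π'}(s₀) − V^{π}(s₀) = (1/(1−γ)) · Σ_{s∈𝒮} d^{π'}_{s₀}(s) · Σ_{a∈𝒜} π'(a|s) · (Q^π(s,a) − V^π(s)), where d^{π'}_{s₀}(s) = (1−γ) · Σ_{k=0}^∞ γ^k · (δ_{s₀}(𝐏^{π'})^k)(s) and δ_{s₀} is the point-mass distribution at s₀. -/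
open Finset

/-- The state-value function V^π(s) = Σ_a π(a|s) Q^π(s,a). -/
noncomputable def Vval {S A : Type*} [Fintype S] [Fintype A] (γ : ℝ)
    (P : S → A → S → ℝ) (r : S → A → ℝ) (π : S → A → ℝ) (s : S) : ℝ :=
  ∑ a, π s a * Qval γ P r π s a

/-- The normalized discounted occupancy measure
`d^{π}_{s₀}(s) = (1−γ) Σ_{k=0}^∞ γ^k (δ_{s₀}(𝐏^{π})^k)(s)`. -/
noncomputable def dOcc {S A : Type*} [Fintype S] [Fintype A] [DecidableEq S] (γ : ℝ)
    (P : S → A → S → ℝ) (π : S → A → ℝ) (s₀ : S) : S → ℝ :=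
  fun s => (1 - γ) * ∑' k : ℕ,
    γ ^ k * rollout P (fun _ => π) (fun s' => if s' = s₀ then (1 : ℝ) else 0) k s

section helpers

variable {S A : Type*} [Fintype S] [Fintype A]

lemma pmat_nonneg {P : S → A → S → ℝ} (hP : IsTransition P) {π : S → A → ℝ} (hπ : IsPolicy π)
    (s s' : S) : 0 ≤ pmat P π s s' :=
  Finset.sum_nonneg fun a _ => mul_nonneg (hπ.1 s a) (hP.1 s a s')

lemma pmat_sum {P : S → A → S → ℝ} (hP : IsTransition P) {π : S → A → ℝ} (hπ : IsPolicy π)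
    (s : S) : ∑ s', pmat P π s s' = 1 := by
  unfold pmat
  rw [Finset.sum_comm]
  simp_rw [← Finset.mul_sum, hP.2, mul_one]
  exact hπ.2 s

lemma l1_dApply {P : S → A → S → ℝ} (hP : IsTransition P) {π : S → A → ℝ} (hπ : IsPolicy π)
    (d : S → ℝ) : l1 (dApply d (pmat P π)) ≤ l1 d := by
  unfold l1 dApply
  calc ∑ s', |∑ s, d s * pmat P π s s'|
      ≤ ∑ s', ∑ s, |d s| * pmat P π s s' := by
        refine Finset.sum_le_sum fun s' _ => (Finset.abs_sum_le_sum_abs _ _).trans ?_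
        refine Finset.sum_le_sum fun s _ => ?_
        rw [abs_mul, abs_of_nonneg (pmat_nonneg hP hπ s s')]
    _ = ∑ s, |d s| := by
        rw [Finset.sum_comm]
        simp_rw [← Finset.mul_sum, pmat_sum hP hπ, mul_one]

lemma l1_rollout {P : S → A → S → ℝ} (hP : IsTransition P) {π : S → A → ℝ} (hπ : IsPolicy π)
    (d : S → ℝ) (k : ℕ) : l1 (rollout P (fun _ => π) d k) ≤ l1 d := by
  induction k with
  | zero => exact le_rfl
  | succ k ih => exact (l1_dApply hP hπ _).trans ih

lemma abs_rollout {P : S → A → S → ℝ} (hP : IsTransition P) {π : S → A → ℝ} (hπ : IsPolicy π)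
    (d : S → ℝ) (k : ℕ) (s : S) : |rollout P (fun _ => π) d k s| ≤ l1 d :=
  (Finset.single_le_sum (f := fun s => |rollout P (fun _ => π) d k s|)
    (fun _ _ => abs_nonneg _) (Finset.mem_univ s)).trans (l1_rollout hP hπ d k)

lemma summable_rollout {P : S → A → S → ℝ} (hP : IsTransition P) {π : S → A → ℝ}
    (hπ : IsPolicy π) {γ : ℝ} (hγ0 : 0 < γ) (hγ1 : γ < 1) (d : S → ℝ) (s : S) :
    Summable fun k : ℕ => γ ^ k * rollout P (fun _ => π) d k s := by
  refine Summable.of_norm_bounded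
    (g := fun k : ℕ => γ ^ k * l1 d) ((summable_geometric_of_lt_one hγ0.le hγ1).mul_right _) ?_
  intro k
  rw [Real.norm_eq_abs, abs_mul, abs_of_pos (pow_pos hγ0 k)]
  exact mul_le_mul_of_nonneg_left (abs_rollout hP hπ d k s) (pow_pos hγ0 k).le

lemma summable_pair {P : S → A → S → ℝ} (hP : IsTransition P) {π : S → A → ℝ}
    (hπ : IsPolicy π) {γ : ℝ} (hγ0 : 0 < γ) (hγ1 : γ < 1) (d f : S → ℝ) :
    Summable fun k : ℕ => γ ^ k * ∑ s, rollout P (fun _ => π) d k s * f s := by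
  have h := summable_sum (s := Finset.univ)
    fun s (_ : s ∈ Finset.univ) => (summable_rollout hP hπ hγ0 hγ1 d s).mul_right (f s)
  refine h.congr fun k => ?_
  simp only [Finset.mul_sum, mul_assoc]

lemma rollout_shift (P : S → A → S → ℝ) (π : S → A → ℝ) (d : S → ℝ) (k : ℕ) :
    rollout P (fun _ => π) d (k + 1) = rollout P (fun _ => π) (dApply d (pmat P π)) k := by
  induction k with
  | zero => rfl
  | succ k ih =>
    show dApply (rollout P (fun _ => π) d (k + 1)) _ = dApply _ _
    rw [ih]

lemma rollout_linear [DecidableEq S] (P : S → A → S → ℝ) (π : S → A → ℝ) (d : S → ℝ) (k : ℕ)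
    (s : S) : rollout P (fun _ => π) d k s
      = ∑ x, d x * rollout P (fun _ => π) (fun s' => if s' = x then (1 : ℝ) else 0) k s := by
  induction k generalizing s with
  | zero => simp [rollout]
  | succ k ih =>
    simp only [rollout, dApply]
    simp_rw [ih, Finset.mul_sum, Finset.sum_mul]
    rw [Finset.sum_comm]
    simp only [mul_assoc]

/-- discounted pairing -/
noncomputable def Uval (γ : ℝ) (P : S → A → S → ℝ) (π : S → A → ℝ) (f d : S → ℝ) : ℝ :=
  ∑' k : ℕ, γ ^ k * ∑ s, rollout P (fun _ => π) d k s * f s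

lemma Uval_step {P : S → A → S → ℝ} (hP : IsTransition P) {π : S → A → ℝ}
    (hπ : IsPolicy π) {γ : ℝ} (hγ0 : 0 < γ) (hγ1 : γ < 1) (f d : S → ℝ) :
    Uval γ P π f d = ∑ s, d s * f s + γ * Uval γ P π f (dApply d (pmat P π)) := by
  unfold Uval
  rw [(summable_pair hP hπ hγ0 hγ1 d f).tsum_eq_zero_add, ← tsum_mul_left]
  simp_rw [rollout_shift]
  congr 1
  · simp [rollout]
  · refine tsum_congr fun k => ?_
    ring

lemma Uval_linear [DecidableEq S] {P : S → A → S → ℝ} (hP : IsTransition P) {π : S → A → ℝ}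
    (hπ : IsPolicy π) {γ : ℝ} (hγ0 : 0 < γ) (hγ1 : γ < 1) (f d : S → ℝ) :
    Uval γ P π f d = ∑ x, d x * Uval γ P π f (fun s' => if s' = x then (1 : ℝ) else 0) := by
  unfold Uval
  simp_rw [← tsum_mul_left]
  rw [← Summable.tsum_finsetSum fun x _ => (summable_pair hP hπ hγ0 hγ1 _ f).mul_left _]
  refine tsum_congr fun k => ?_
  simp_rw [rollout_linear P π d k, Finset.sum_mul, Finset.mul_sum]
  rw [Finset.sum_comm]
  refine Finset.sum_congr rfl fun x _ => Finset.sum_congr rfl fun s _ => ?_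
  ring

lemma Qval_eq_U (γ : ℝ) (P : S → A → S → ℝ) (r : S → A → ℝ) (π : S → A → ℝ) (s : S) (a : A) :
    Qval γ P r π s a = r s a + γ * Uval γ P π (rpol r π) (P s a) := by
  unfold Qval Uval
  rw [← tsum_mul_left]
  congr 1
  refine tsum_congr fun k => ?_
  ring

lemma avg_eq (γ : ℝ) (P : S → A → S → ℝ) (r : S → A → ℝ) (π : S → A → ℝ) (v : S → ℝ) (s : S) :
    ∑ a, π s a * (r s a + γ * ∑ x, P s a x * v x)
      = rpol r π s + γ * ∑ x, pmat P π s x * v x := by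
  simp only [rpol, pmat, mul_add, Finset.sum_add_distrib]
  congr 1
  simp_rw [Finset.mul_sum, Finset.sum_mul, Finset.mul_sum]
  rw [Finset.sum_comm]
  refine Finset.sum_congr rfl fun x _ => Finset.sum_congr rfl fun s _ => ?_
  ring

lemma Vval_eq_U [DecidableEq S] {P : S → A → S → ℝ} (hP : IsTransition P) {π : S → A → ℝ}
    (hπ : IsPolicy π) {γ : ℝ} (hγ0 : 0 < γ) (hγ1 : γ < 1) (r : S → A → ℝ) (s : S) :
    Vval γ P r π s = Uval γ P π (rpol r π) (fun s' => if s' = s then (1 : ℝ) else 0) := by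
  unfold Vval
  simp_rw [Qval_eq_U, fun a => Uval_linear hP hπ hγ0 hγ1 (rpol r π) (P s a)]
  rw [avg_eq, Uval_step hP hπ hγ0 hγ1]
  have h : dApply (fun s' => if s' = s then (1 : ℝ) else 0) (pmat P π) = pmat P π s := by
    funext x
    simp [dApply]
  rw [h, Uval_linear hP hπ hγ0 hγ1 _ (pmat P π s)]
  simp

lemma Qval_bellman {P : S → A → S → ℝ} (hP : IsTransition P) {π : S → A → ℝ}
    (hπ : IsPolicy π) {γ : ℝ} (hγ0 : 0 < γ) (hγ1 : γ < 1) (r : S → A → ℝ) (s : S) (a : A) :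
    Qval γ P r π s a = r s a + γ * ∑ x, P s a x * Vval γ P r π x := by
  classical
  rw [Qval_eq_U, Uval_linear hP hπ hγ0 hγ1]
  simp_rw [Vval_eq_U hP hπ hγ0 hγ1]

/-- Solution of the resolvent equation. -/
lemma Uval_resolvent {P : S → A → S → ℝ} (hP : IsTransition P) {π : S → A → ℝ}
    (hπ : IsPolicy π) {γ : ℝ} (hγ0 : 0 < γ) (hγ1 : γ < 1) (g w d : S → ℝ)
    (hw : ∀ s, w s = g s + γ * ∑ x, pmat P π s x * w x) :
    ∑ s, d s * w s = Uval γ P π g d := by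
  have h1 : Uval γ P π w d
      = Uval γ P π g d + γ * Uval γ P π w (dApply d (pmat P π)) := by
    unfold Uval
    rw [← tsum_mul_left, ← Summable.tsum_add (summable_pair hP hπ hγ0 hγ1 _ _)
      ((summable_pair hP hπ hγ0 hγ1 _ _).mul_left _)]
    refine tsum_congr fun k => ?_
    rw [← rollout_shift]
    have : ∑ s, rollout P (fun _ => π) d k s * w s
        = ∑ s, rollout P (fun _ => π) d k s * g s
          + γ * ∑ s, rollout P (fun _ => π) d (k + 1) s * w s := by
      conv_lhs => enter [2, s]; rw [hw s]
      simp only [rollout, dApply, mul_add, Finset.sum_add_distrib]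
      congr 1
      simp_rw [Finset.sum_mul, Finset.mul_sum]
      rw [Finset.sum_comm]
      refine Finset.sum_congr rfl fun x _ => Finset.sum_congr rfl fun s _ => ?_
      ring
    rw [this]
    ring
  have h2 := Uval_step hP hπ hγ0 hγ1 w d
  linarith

end helpers

theorem stmt12 {S A : Type*} [Fintype S] [Fintype A] [DecidableEq S]
    [Nonempty S] [Nonempty A]
    (γ : ℝ) (hγ0 : 0 < γ) (hγ1 : γ < 1)
    (P : S → A → S → ℝ) (hP : IsTransition P)
    (r : S → A → ℝ) (hr : ∀ s a, 0 ≤ r s a ∧ r s a ≤ 1)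
    (π π' : S → A → ℝ) (hπ : IsPolicy π) (hπ' : IsPolicy π') (s₀ : S) :
    Vval γ P r π' s₀ - Vval γ P r π s₀
      = (1 / (1 - γ)) * ∑ s, dOcc γ P π' s₀ s *
          ∑ a, π' s a * (Qval γ P r π s a - Vval γ P r π s) := by
  set g : S → ℝ := fun s => ∑ a, π' s a * (Qval γ P r π s a - Vval γ P r π s) with hg
  have hgs : ∀ s, g s = rpol r π' s + γ * ∑ x, pmat P π' s x * Vval γ P r π x
      - Vval γ P r π s := by
    intro s
    simp only [hg, mul_sub, Finset.sum_sub_distrib, ← Finset.sum_mul, hπ'.2 s, one_mul]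
    simp_rw [Qval_bellman hP hπ hγ0 hγ1]
    rw [avg_eq]
  have hV' : ∀ s, Vval γ P r π' s
      = rpol r π' s + γ * ∑ x, pmat P π' s x * Vval γ P r π' x := by
    intro s
    rw [← avg_eq]
    simp_rw [← Qval_bellman hP hπ' hγ0 hγ1]
    rfl
  have hmain := Uval_resolvent hP hπ' hγ0 hγ1 g
    (fun s => Vval γ P r π' s - Vval γ P r π s) (fun s' => if s' = s₀ then (1 : ℝ) else 0)
    (by
      intro s
      simp only [mul_sub, Finset.sum_sub_distrib]
      rw [hgs s]
      linarith [hV' s])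
  have hL : ∑ s, (if s = s₀ then (1 : ℝ) else 0) * (Vval γ P r π' s - Vval γ P r π s)
      = Vval γ P r π' s₀ - Vval γ P r π s₀ := by simp
  rw [← hL, hmain]
  have h1 : (1 - γ) ≠ 0 := by linarith
  unfold Uval dOcc
  simp_rw [mul_assoc (1 - γ), ← Finset.mul_sum]
  rw [← mul_assoc, one_div_mul_cancel h1, one_mul]
  simp_rw [← tsum_mul_right]
  rw [← Summable.tsum_finsetSum fun x _ => (summable_rollout hP hπ' hγ0 hγ1 _ x).mul_right _]
  refine tsum_congr fun k => ?_
  simp only [hg, Finset.mul_sum, mul_assoc]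
end

section
/- (One step of EXP3) With p and p' the EXP3 action distributions before and after one update, the probability of the chosen arm satisfies p'(a₀) − p(a₀) ≤ 2η/A. -/
open Finset

/-- The EXP3 action distribution induced by weights w:
`p(a) = (1−η) w(a)/W + η/A` with `W = Σ_b w(b)`. -/
noncomputable def exp3p (A : ℕ) (η : ℝ) (w : Fin A → ℝ) : Fin A → ℝ :=
  fun a => (1 - η) * w a / (∑ b, w b) + η / A

/-- The EXP3 weight update after the chosen arm a₀ receives reward y:
only the weight of a₀ is multiplied by `exp((1−γ)·η·ŷ/A)` where `ŷ = y/p(a₀)`. -/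
noncomputable def exp3update (A : ℕ) (η γ y : ℝ) (w : Fin A → ℝ) (a₀ : Fin A) :
    Fin A → ℝ :=
  fun a => if a = a₀ then
    w a₀ * Real.exp ((1 - γ) * η * (y / exp3p A η w a₀) / A)
  else w a

theorem stmt16 (A : ℕ) (hA : 1 ≤ A) (η γ : ℝ) (hη0 : 0 < η) (hη1 : η ≤ 1)
    (hγ0 : 0 ≤ γ) (hγ1 : γ < 1)
    (w : Fin A → ℝ) (hw : ∀ a, 0 < w a)
    (a₀ : Fin A) (y : ℝ) (hy0 : 0 ≤ y) (hy1 : y ≤ 1 / (1 - γ)) :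
    exp3p A η (exp3update A η γ y w a₀) a₀ - exp3p A η w a₀ ≤ 2 * η / A := by
  have hA' : (0:ℝ) < A := by exact_mod_cast hA
  have hW : 0 < ∑ b, w b := Finset.sum_pos (fun b _ => hw b) ⟨a₀, Finset.mem_univ _⟩
  have hg : 0 < 1 - γ := by linarith
  have hηA : 0 < η / A := by positivity
  have hq : 0 ≤ (1 - η) * w a₀ / (∑ b, w b) :=
    div_nonneg (mul_nonneg (by linarith) (hw a₀).le) hW.le
  have hpdef : exp3p A η w a₀ = (1 - η) * w a₀ / (∑ b, w b) + η / A := rfl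
  have hp : 0 < exp3p A η w a₀ := by rw [hpdef]; linarith
  have hy : (1 - γ) * y ≤ 1 := by
    rw [le_div_iff₀ hg] at hy1; linarith
  have hgy : 0 ≤ (1 - γ) * y := mul_nonneg hg.le hy0
  set x : ℝ := (1 - γ) * η * (y / exp3p A η w a₀) / A with hx
  have hpx : exp3p A η w a₀ * x = ((1 - γ) * y) * (η / A) := by
    rw [hx]; field_simp
  have hpx1 : exp3p A η w a₀ * x ≤ η / A := by
    rw [hpx]; nlinarith
  have hx0 : 0 ≤ x := by
    by_contra h
    push Not at h
    have h1 := mul_neg_of_pos_of_neg hp h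
    have h2 := mul_nonneg hgy hηA.le
    linarith
  have hx1 : x ≤ 1 := by
    by_contra h
    push Not at h
    have h1 : exp3p A η w a₀ * 1 < exp3p A η w a₀ * x := mul_lt_mul_of_pos_left h hp
    linarith
  have hexp : Real.exp x - 1 ≤ 2 * x := by
    have h := Real.abs_exp_sub_one_sub_id_le (x := x) (by rw [abs_of_nonneg hx0]; exact hx1)
    have h2 := (abs_le.mp h).2
    nlinarith
  have hexp1 : 1 ≤ Real.exp x := Real.one_le_exp hx0
  have hu : exp3update A η γ y w a₀ a₀ = w a₀ * Real.exp x := by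
    simp [exp3update, hx]
  have hWW : ∑ b, w b ≤ ∑ b, exp3update A η γ y w a₀ b := by
    apply Finset.sum_le_sum
    intro b _
    by_cases hb : b = a₀
    · subst hb
      rw [hu]
      exact le_mul_of_one_le_right (hw b).le hexp1
    · simp [exp3update, hb]
  have hp' : exp3p A η (exp3update A η γ y w a₀) a₀
      ≤ (1 - η) * w a₀ / (∑ b, w b) * Real.exp x + η / A := by
    have h : exp3p A η (exp3update A η γ y w a₀) a₀ =
      (1 - η) * (w a₀ * Real.exp x) / (∑ b, exp3update A η γ y w a₀ b) + η / A := by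
      rw [← hu]; rfl
    rw [h]
    have h2 : (1 - η) * (w a₀ * Real.exp x) / (∑ b, exp3update A η γ y w a₀ b)
        ≤ (1 - η) * (w a₀ * Real.exp x) / (∑ b, w b) :=
      div_le_div_of_nonneg_left
        (mul_nonneg (by linarith) (mul_nonneg (hw a₀).le (Real.exp_pos x).le)) hW hWW
    have h3 : (1 - η) * (w a₀ * Real.exp x) / (∑ b, w b)
      = (1 - η) * w a₀ / (∑ b, w b) * Real.exp x := by ring
    linarith
  have h4 : (1 - η) * w a₀ / (∑ b, w b) * (Real.exp x - 1)
      ≤ exp3p A η w a₀ * (2 * x) :=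
    mul_le_mul (by rw [hpdef]; linarith) hexp (by linarith) hp.le
  have h5 : 2 * η / A = 2 * (η / A) := by ring
  rw [h5]
  linarith
end

section
/- (EXP3 is slowly changing) With p and p' the EXP3 action distributions before and after one update, Σ_{a} |p'(a) − p(a)| ≤ 4η/A. -/
open Finset

theorem stmt17 (A : ℕ) (hA : 1 ≤ A) (η γ : ℝ) (hη0 : 0 < η) (hη1 : η ≤ 1)
    (hγ0 : 0 ≤ γ) (hγ1 : γ < 1)
    (w : Fin A → ℝ) (hw : ∀ a, 0 < w a)
    (a₀ : Fin A) (y : ℝ) (hy0 : 0 ≤ y) (hy1 : y ≤ 1 / (1 - γ)) :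
    ∑ a, |exp3p A η (exp3update A η γ y w a₀) a - exp3p A η w a| ≤ 4 * η / A := by
  have hApos : (0 : ℝ) < A := by exact_mod_cast hA
  have hg : 0 < 1 - γ := by linarith
  have hW : 0 < ∑ b, w b := Finset.sum_pos (fun a _ => hw a) ⟨a₀, Finset.mem_univ _⟩
  set W := ∑ b, w b with hWdef
  set p := exp3p A η w a₀ with hp
  have hpeq : p = (1 - η) * (w a₀ / W) + η / A := by
    rw [hp, exp3p, mul_div_assoc]
  have hq0 : 0 < w a₀ / W := div_pos (hw a₀) hW
  have hηA : 0 < η / A := div_pos hη0 hApos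
  have h1η : 0 ≤ 1 - η := by linarith
  have hqn : 0 ≤ (1 - η) * (w a₀ / W) := mul_nonneg h1η hq0.le
  have hp0 : 0 < p := by rw [hpeq]; linarith
  set x := (1 - γ) * η * (y / p) / A with hx
  have hx0 : 0 ≤ x := by positivity
  have hpx : p * x ≤ η / A := by
    have h1 : p * x = ((1 - γ) * y) * (η / A) := by
      rw [hx]; field_simp
    have h2 : (1 - γ) * y ≤ 1 := by
      rw [le_div_iff₀ hg] at hy1; linarith
    rw [h1]; nlinarith
  have hx1 : x ≤ 1 := by
    have h1 : η / A ≤ p := by rw [hpeq]; linarith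
    by_contra h
    push Not at h
    nlinarith
  have hE : Real.exp x - 1 ≤ 2 * x := by
    have h := Real.abs_exp_sub_one_le (x := x) (by rw [abs_of_nonneg hx0]; exact hx1)
    rw [abs_of_nonneg hx0] at h
    exact (le_abs_self _).trans h
  have hE0 : 0 ≤ Real.exp x - 1 := by
    have := Real.add_one_le_exp x
    linarith
  obtain ⟨d, hd⟩ : ∃ d, d = w a₀ * (Real.exp x - 1) := ⟨_, rfl⟩
  have hd0 : 0 ≤ d := by rw [hd]; exact mul_nonneg (hw a₀).le hE0
  have hupd : ∀ a, exp3update A η γ y w a₀ a = w a + if a = a₀ then d else 0 := by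
    intro a
    unfold exp3update
    split_ifs with h
    · subst h
      rw [hd, hx, hp]; ring
    · simp
  have hW' : ∑ b, exp3update A η γ y w a₀ b = W + d := by
    simp_rw [hupd]
    rw [Finset.sum_add_distrib]
    simp [hWdef]
  have hWd : 0 < W + d := by linarith
  have hterm : ∀ a, |exp3p A η (exp3update A η γ y w a₀) a - exp3p A η w a| ≤
      (1 - η) * (d / (W * (W + d))) * w a + if a = a₀ then (1 - η) * (d / (W + d)) else 0 := by
    intro a
    have e : exp3p A η (exp3update A η γ y w a₀) a - exp3p A η w a =
        (if a = a₀ then (1 - η) * (d / (W + d)) else 0)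
          - (1 - η) * (d / (W * (W + d))) * w a := by
      unfold exp3p
      rw [hW', hupd, ← hWdef]
      split_ifs
      · field_simp; ring
      · field_simp; ring
    have n1 : 0 ≤ (1 - η) * (d / (W * (W + d))) * w a :=
      mul_nonneg (mul_nonneg h1η (by positivity)) (hw a).le
    have n2 : 0 ≤ (if a = a₀ then (1 - η) * (d / (W + d)) else 0) := by
      split_ifs
      · exact mul_nonneg h1η (by positivity)
      · exact le_rfl
    rw [e, abs_le]
    constructor <;> linarith
  have hdW : d / (W + d) ≤ d / W := by
    apply div_le_div_of_nonneg_left hd0 hW; linarith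
  have hdq : d / W ≤ w a₀ / W * (2 * x) := by
    have : d / W = w a₀ / W * (Real.exp x - 1) := by rw [hd]; ring
    rw [this]
    exact mul_le_mul_of_nonneg_left hE hq0.le
  calc _ ≤ ∑ a, ((1 - η) * (d / (W * (W + d))) * w a
        + if a = a₀ then (1 - η) * (d / (W + d)) else 0) :=
        Finset.sum_le_sum (fun a _ => hterm a)
    _ = 2 * ((1 - η) * (d / (W + d))) := by
        rw [Finset.sum_add_distrib, ← Finset.mul_sum, ← hWdef]
        simp only [Finset.sum_ite_eq', Finset.mem_univ, if_true]
        field_simp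
        ring
    _ ≤ 2 * ((1 - η) * (w a₀ / W * (2 * x))) := by
        have := mul_le_mul_of_nonneg_left (hdW.trans hdq) h1η
        linarith
    _ = 4 * (((1 - η) * (w a₀ / W)) * x) := by ring
    _ ≤ 4 * (p * x) := by
        have : (1 - η) * (w a₀ / W) ≤ p := by rw [hpeq]; linarith
        have := mul_le_mul_of_nonneg_right this hx0
        linarith
    _ ≤ 4 * η / A := by
        rw [mul_div_assoc]; linarith
end
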